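/- arXiv:1711.10763 — 2 statements merged into one kernel-verified Lean document; each statement's English description precedes it below -/
import Mathlib

section
/- The dynamical system (Y, F) is Li-Yorke sensitive with sensitivity constant 1/2: for every x ∈ Y and every neighborhood U of x in Y, there exists y ∈ U such that liminf_{n→∞} D(Fⁿ(x), Fⁿ(y)) = 0 and limsup_{n→∞} D(Fⁿ(x), Fⁿ(y)) ≥ 1/2. -/
open Filter

noncomputable section

instance : Fact ((0:ℝ) < 1) := ⟨one_pos⟩

/-- The unit circle `𝕊 = ℝ/ℤ` (with the metric `d₀(x,y) = min{|x−y|, 1−|x−y|}`). -/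
abbrev Circle1 := AddCircle (1 : ℝ)

/-- Points of the product space `Π_{i=0}^∞ X_i = 𝕊 × Π_{i≥1} (ℕ ∪ {∞})`:
the first component is the circle coordinate `x₀`, and the second component gives
the coordinates `x_i ∈ ℕ ∪ {∞}` for `i ≥ 1`. -/
abbrev Pt := Circle1 × (ℕ+ → ℕ∞)

/-- `1/x` for `x ∈ ℕ ∪ {∞}`, with the convention `1/∞ = 0`. -/
noncomputable def einv (x : ℕ∞) : ℝ := ((x.toNat : ℕ) : ℝ)⁻¹

/-- The metric `d_i(x,y) = |1/x − 1/y|` on `ℕ ∪ {∞}` (for `i ≥ 1`). -/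
noncomputable def dE (x y : ℕ∞) : ℝ := |einv x - einv y|

/-- The metric `D(x,y) = Σ_{i=0}^∞ d_i(x_i,y_i)/2^i` on the product space. -/
noncomputable def D (x y : Pt) : ℝ :=
  dist x.1 y.1 + ∑' i : ℕ+, dE (x.2 i) (y.2 i) / 2 ^ (i : ℕ)

/-- `Y`: the set of points whose sequence of coordinates `(x_i)_{i≥1}` is a nondecreasing
sequence in `ℕ ∪ {∞}` (with `ℕ = {1,2,…}`). -/
def Y : Set Pt := {x | (∀ i, 1 ≤ x.2 i) ∧ Monotone x.2}

/-- The skew-product map `F`: `f₀(x) = (x₀ + Σ_{i≥1} 2^{−i}·(1/x_i)) mod 1` and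
`f_i(x) = x_i + 1` for `i ≥ 1`, with `∞ + 1 = ∞`. -/
noncomputable def F (x : Pt) : Pt :=
  (x.1 + (((∑' i : ℕ+, (1 / 2 ^ (i : ℕ)) * einv (x.2 i)) : ℝ) : Circle1),
   fun i => x.2 i + 1)

/-- `(x, y)` is a scrambled pair of `F`:
`liminf_{n→∞} D(Fⁿ(x), Fⁿ(y)) = 0` and `limsup_{n→∞} D(Fⁿ(x), Fⁿ(y)) > 0`. -/
def ScrambledPair (x y : Pt) : Prop :=
  liminf (fun n : ℕ => D (F^[n] x) (F^[n] y)) atTop = 0 ∧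
  0 < limsup (fun n : ℕ => D (F^[n] x) (F^[n] y)) atTop

/-- A sequence tending to infinity whose increments tend to zero comes arbitrarily close to
translates of any `t` by natural numbers, arbitrarily late. -/
lemma frequently_abs_sub_natCast_add_le {s : ℕ → ℝ} (hs : Tendsto s atTop atTop)
    (hd : Tendsto (fun n => s (n + 1) - s n) atTop (nhds 0)) (t : ℝ) {ε : ℝ} (hε : 0 < ε) :
    ∃ᶠ n in atTop, ∃ M : ℕ, |s n - M - t| ≤ ε := by
  rw [frequently_atTop]
  intro N
  obtain ⟨N₁, hN₁⟩ := eventually_atTop.1 (hd.eventually_lt_const hε)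
  set K := max N N₁
  obtain ⟨M, hM⟩ := exists_nat_gt (s K - t)
  have hex : ∃ k, (M : ℝ) + t ≤ s (K + k) := by
    obtain ⟨n, hn, hKn⟩ := ((hs.eventually_ge_atTop ((M : ℝ) + t)).and
      (eventually_ge_atTop K)).exists
    exact ⟨n - K, by rwa [Nat.add_sub_cancel' hKn]⟩
  classical
  have hfind := Nat.find_spec hex
  obtain ⟨j, hj⟩ : ∃ j, Nat.find hex = j + 1 := by
    refine Nat.exists_eq_succ_of_ne_zero fun h => ?_
    rw [h, add_zero] at hfind
    linarith
  have hlt : s (K + j) < M + t := not_le.1 (Nat.find_min hex (by omega))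
  rw [hj] at hfind
  have hinc := hN₁ (K + j) (by omega)
  rw [← add_assoc] at hfind
  exact ⟨K + j + 1, by omega, M, abs_le.2 ⟨by linarith, by linarith⟩⟩

lemma abs_norm_coe_sub_norm_coe_le (s t : ℝ) (M : ℕ) :
    |‖(s : Circle1)‖ - ‖(t : Circle1)‖| ≤ |s - M - t| := by
  have hM : ((M : ℝ) : Circle1) = 0 := by
    have := AddCircle.coe_nsmul (1 : ℝ) (n := M) (x := 1)
    rw [nsmul_eq_mul, mul_one] at this
    rw [this, AddCircle.coe_period, smul_zero]
  have h : ((s - M - t : ℝ) : Circle1) = (s : Circle1) - (t : Circle1) := by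
    rw [AddCircle.coe_sub, AddCircle.coe_sub, hM, sub_zero]
  refine (abs_norm_sub_norm_le _ _).trans ?_
  rw [← h, ← Real.norm_eq_abs]
  exact QuotientAddGroup.norm_mk_le_norm

lemma summable_one_div_two_pow_pnat : Summable fun i : ℕ+ => (1 : ℝ) / 2 ^ (i : ℕ) := by
  have h : Summable fun i : ℕ => (1 : ℝ) / 2 ^ i := by
    simpa using summable_geometric_two
  exact h.comp_injective PNat.coe_injective

@[simp] lemma einv_top : einv ⊤ = 0 := by simp [einv]

lemma einv_natCast (n : ℕ) : einv n = (n : ℝ)⁻¹ := by simp [einv]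

lemma einv_nonneg (a : ℕ∞) : 0 ≤ einv a := by unfold einv; positivity

lemma einv_anti {a b : ℕ∞} (ha : 1 ≤ a) (hab : a ≤ b) : einv b ≤ einv a := by
  induction b using ENat.recTopCoe with
  | top => simpa using einv_nonneg a
  | coe b =>
    lift a to ℕ using ne_top_of_le_ne_top (ENat.natCast_ne_top b) hab
    rw [einv_natCast, einv_natCast]
    have ha' : 0 < a := by exact_mod_cast ha
    exact inv_anti₀ (by exact_mod_cast ha') (by exact_mod_cast hab)

lemma einv_add_le {a : ℕ∞} (ha : 1 ≤ a) (k : ℕ) : einv (a + k) ≤ 1 / ((k : ℝ) + 1) := by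
  have h := einv_anti (a := ((k + 1 : ℕ) : ℕ∞)) (b := a + k)
    (by exact_mod_cast Nat.le_add_left 1 k)
    (by push_cast; rw [add_comm a]; gcongr)
  rw [einv_natCast] at h
  simpa using h

/-- The rotation angle `Σ_{i≥1} 2^{−i}·(1/(x_i+k))` applied at time `k`. -/
def angle (x : ℕ+ → ℕ∞) (k : ℕ) : ℝ := ∑' i : ℕ+, (1 / 2 ^ (i : ℕ)) * einv (x i + k)

lemma iterate_F (x : Pt) (n : ℕ) :
    F^[n] x = (x.1 + ((∑ k ∈ Finset.range n, angle x.2 k : ℝ) : Circle1),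
      fun i => x.2 i + n) := by
  induction n with
  | zero => simp
  | succ n ih =>
    rw [Function.iterate_succ_apply', ih, F, Finset.sum_range_succ]
    ext1
    · simp only [angle, AddCircle.coe_add, add_assoc]
    · simp [add_assoc]

lemma summable_angle {x : ℕ+ → ℕ∞} (hx : ∀ i, 1 ≤ x i) (k : ℕ) :
    Summable fun i : ℕ+ => (1 / 2 ^ (i : ℕ)) * einv (x i + k) := by
  refine .of_nonneg_of_le (fun i => mul_nonneg (by positivity) (einv_nonneg _)) (fun i => ?_)
    (summable_one_div_two_pow_pnat.mul_right (1 / ((k : ℝ) + 1)))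
  exact mul_le_mul_of_nonneg_left (einv_add_le (hx i) k) (by positivity)

lemma dE_comm (a b : ℕ∞) : dE a b = dE b a := abs_sub_comm _ _

lemma D_comm (x y : Pt) : D x y = D y x := by
  simp only [D, dist_comm x.1, dE_comm (x.2 _)]

/-- For comparable sequences, the second summand of `D` after `n` steps is the difference of the
rotation angles at time `n`. -/
lemma tsum_dE_eq {x y : ℕ+ → ℕ∞} (hx : ∀ i, 1 ≤ x i) (hxy : x ≤ y) (n : ℕ) :
    ∑' i : ℕ+, dE (x i + n) (y i + n) / 2 ^ (i : ℕ) = angle x n - angle y n := by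
  have hy : ∀ i, 1 ≤ y i := fun i => (hx i).trans (hxy i)
  rw [angle, angle, ← (summable_angle hx n).tsum_sub (summable_angle hy n)]
  refine tsum_congr fun i => ?_
  have h : einv (y i + n) ≤ einv (x i + n) :=
    einv_anti ((hx i).trans le_self_add) (by gcongr; exact hxy i)
  rw [dE, abs_of_nonneg (sub_nonneg.2 h)]
  ring

lemma angle_sub_nonneg {x y : ℕ+ → ℕ∞} (hx : ∀ i, 1 ≤ x i) (hxy : x ≤ y) (n : ℕ) :
    0 ≤ angle x n - angle y n := by
  rw [← tsum_dE_eq hx hxy]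
  exact tsum_nonneg fun i => div_nonneg (abs_nonneg _) (by positivity)

lemma angle_nonneg (x : ℕ+ → ℕ∞) (n : ℕ) : 0 ≤ angle x n :=
  tsum_nonneg fun _ => mul_nonneg (by positivity) (einv_nonneg _)

lemma tendsto_angle {x : ℕ+ → ℕ∞} (hx : ∀ i, 1 ≤ x i) :
    Tendsto (angle x) atTop (nhds 0) := by
  have h := (tendsto_one_div_add_atTop_nhds_zero_nat (𝕜 := ℝ)).const_mul
    (∑' i : ℕ+, (1 : ℝ) / 2 ^ (i : ℕ))
  rw [mul_zero] at h
  refine squeeze_zero (angle_nonneg x) (fun k => ?_) h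
  rw [← tsum_mul_right]
  exact (summable_angle hx k).tsum_le_tsum
    (fun i => mul_le_mul_of_nonneg_left (einv_add_le (hx i) k) (by positivity))
    (summable_one_div_two_pow_pnat.mul_right _)

lemma tendsto_sum_angle_sub {x y : ℕ+ → ℕ∞} (hx : ∀ i, 1 ≤ x i) (hxy : x ≤ y)
    {j : ℕ+} (hxj : x j ≠ ⊤) (hyj : y j = ⊤) :
    Tendsto (fun n => ∑ k ∈ Finset.range n, (angle x k - angle y k)) atTop atTop := by
  lift x j to ℕ using hxj with a ha
  have ha1 : 1 ≤ a := by have := hx j; rw [← ha] at this; exact_mod_cast this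
  have ha0 : (1 : ℝ) ≤ a := by exact_mod_cast ha1
  have hy : ∀ i, 1 ≤ y i := fun i => (hx i).trans (hxy i)
  set c : ℝ := 1 / 2 ^ (j : ℕ) * (a : ℝ)⁻¹
  have hc : 0 < c := by positivity
  refine tendsto_atTop_mono (fun n => ?_)
    (Real.tendsto_sum_range_one_div_nat_succ_atTop.const_mul_atTop hc)
  rw [Finset.mul_sum]
  refine Finset.sum_le_sum fun k _ => ?_
  rw [angle, angle, ← (summable_angle hx k).tsum_sub (summable_angle hy k)]
  refine le_trans ?_ (((summable_angle hx k).sub (summable_angle hy k)).le_tsum j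
    fun i _ => ?_)
  · have h : einv (x j + k) = ((a : ℝ) + k)⁻¹ := by
      rw [← ha, ← Nat.cast_add, einv_natCast, Nat.cast_add]
    rw [h, hyj, top_add, einv_top, mul_zero, sub_zero, mul_assoc, one_div ((k : ℝ) + 1),
      ← mul_inv]
    gcongr
    nlinarith [(Nat.cast_nonneg k : (0 : ℝ) ≤ k)]
  · rw [← mul_sub]
    exact mul_nonneg (by positivity) (sub_nonneg.2
      (einv_anti ((hx i).trans le_self_add) (by gcongr; exact hxy i)))

/-- Two points with the same circle coordinate and comparable sequences, such that some coordinate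
is infinite for exactly one of them, form a Li-Yorke pair with constant `1/2`. -/
lemma liYorke_of_le {x y : Pt} (hx : ∀ i, 1 ≤ x.2 i) (h0 : x.1 = y.1) (hxy : x.2 ≤ y.2)
    {j : ℕ+} (hxj : x.2 j ≠ ⊤) (hyj : y.2 j = ⊤) :
    liminf (fun n : ℕ => D (F^[n] x) (F^[n] y)) atTop = 0 ∧
      1 / 2 ≤ limsup (fun n : ℕ => D (F^[n] x) (F^[n] y)) atTop := by
  set g : ℕ → ℝ := fun k => angle x.2 k - angle y.2 k with hg
  set s : ℕ → ℝ := fun n => ∑ k ∈ Finset.range n, g k with hs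
  have hD : ∀ n, D (F^[n] x) (F^[n] y) = ‖(s n : Circle1)‖ + g n := fun n => by
    rw [D, iterate_F, iterate_F]
    dsimp only
    rw [tsum_dE_eq hx hxy, h0, dist_add_left, dist_eq_norm, ← AddCircle.coe_sub,
      ← Finset.sum_sub_distrib]
  simp only [hD]
  have hg0 : ∀ n, 0 ≤ g n := angle_sub_nonneg hx hxy
  have hgt : Tendsto g atTop (nhds 0) := by
    simpa using (tendsto_angle hx).sub (tendsto_angle fun i => (hx i).trans (hxy i))
  have hst : Tendsto s atTop atTop := tendsto_sum_angle_sub hx hxy hxj hyj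
  have hsd : Tendsto (fun n => s (n + 1) - s n) atTop (nhds 0) := by
    simpa [hs, Finset.sum_range_succ] using hgt
  have hbelow : ∀ n, 0 ≤ ‖(s n : Circle1)‖ + g n := fun n =>
    add_nonneg (norm_nonneg _) (hg0 n)
  have hbddBelow : IsBoundedUnder (· ≥ ·) atTop fun n => ‖(s n : Circle1)‖ + g n :=
    isBoundedUnder_of ⟨0, hbelow⟩
  have hbddAbove : IsBoundedUnder (· ≤ ·) atTop fun n => ‖(s n : Circle1)‖ + g n := by
    refine isBoundedUnder_of_eventually_le (a := |1| / 2 + 1) ?_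
    filter_upwards [hgt.eventually_le_const one_pos] with n hn
    exact add_le_add (AddCircle.norm_le_half_period (1 : ℝ) one_ne_zero) hn
  refine ⟨le_antisymm ?_ ?_, ?_⟩
  · refine le_of_forall_pos_le_add fun ε hε => ?_
    rw [zero_add]
    refine liminf_le_of_frequently_le ?_ hbddBelow
    refine ((frequently_abs_sub_natCast_add_le hst hsd 0 (half_pos hε)).and_eventually
      (hgt.eventually_le_const (half_pos hε))).mono ?_
    rintro n ⟨⟨M, hM⟩, hn⟩
    have h := (abs_le.1 ((abs_norm_coe_sub_norm_coe_le (s n) 0 M).trans hM)).2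
    rw [AddCircle.coe_zero, norm_zero] at h
    linarith
  · exact le_liminf_of_le hbddAbove.isCoboundedUnder_ge (.of_forall hbelow)
  · refine le_of_forall_pos_le_add fun ε hε => ?_
    rw [← sub_le_iff_le_add]
    refine le_limsup_of_frequently_le ?_ hbddAbove
    refine (frequently_abs_sub_natCast_add_le hst hsd (1 / 2) hε).mono ?_
    rintro n ⟨M, hM⟩
    have h := (abs_le.1 ((abs_norm_coe_sub_norm_coe_le (s n) (1 / 2) M).trans hM)).1
    rw [AddCircle.norm_half_period_eq, abs_one] at h
    linarith [hg0 n]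

/-- Truncating a sequence from above by larger and larger constants approximates it. -/
lemma tendsto_min_natCast (x : ℕ+ → ℕ∞) :
    Tendsto (fun (m : ℕ) i => min (x i) m) atTop (nhds x) := by
  refine tendsto_pi_nhds.2 fun i => ?_
  simpa using (tendsto_const_nhds (x := x i)).min ENat.tendsto_natCast_nhds_top

/-- Replacing later and later tails of a sequence by `∞` approximates it. -/
lemma tendsto_ite_le_top (x : ℕ+ → ℕ∞) :
    Tendsto (fun (m : ℕ) (i : ℕ+) => if (i : ℕ) ≤ m then x i else ⊤) atTop (nhds x) := by
  refine tendsto_pi_nhds.2 fun i => tendsto_const_nhds.congr' ?_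
  filter_upwards [eventually_ge_atTop (i : ℕ)] with m hm
  rw [if_pos hm]

/-- A neighbourhood of `x` within `Y` contains all late members of a sequence of points of `Y`
which share the circle coordinate of `x` and converge to `x`. -/
lemma eventually_mem_inter_Y {x : Pt} {U : Set Pt} (hU : U ∈ nhdsWithin x Y)
    {z : ℕ → ℕ+ → ℕ∞} (hz : Tendsto z atTop (nhds x.2)) (hY : ∀ᶠ m in atTop, (x.1, z m) ∈ Y) :
    ∀ᶠ m in atTop, (x.1, z m) ∈ U ∩ Y := by
  have h : Tendsto (fun m => (x.1, z m)) atTop (nhdsWithin x Y) :=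
    tendsto_nhdsWithin_iff.2 ⟨tendsto_const_nhds.prodMk_nhds hz, hY⟩
  exact (h.eventually hU).and hY

/-- `(Y, F)` is Li-Yorke sensitive with sensitivity constant `1/2`: for every `x ∈ Y` and
every neighborhood `U` of `x` in `Y`, there exists `y ∈ U` (a point of `Y`) such that
`liminf_{n→∞} D(Fⁿ(x), Fⁿ(y)) = 0` and `limsup_{n→∞} D(Fⁿ(x), Fⁿ(y)) ≥ 1/2`. -/
theorem YF_liYorke_sensitive :
    ∀ x ∈ Y, ∀ U ∈ nhdsWithin x Y, ∃ y ∈ U ∩ Y,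
      liminf (fun n : ℕ => D (F^[n] x) (F^[n] y)) atTop = 0 ∧
      1 / 2 ≤ limsup (fun n : ℕ => D (F^[n] x) (F^[n] y)) atTop := by
  rintro x ⟨hx1, hxm⟩ U hU
  by_cases htop : ∃ j, x.2 j = ⊤
  · obtain ⟨j, hj⟩ := htop
    have hY : ∀ᶠ m : ℕ in atTop, (x.1, fun i => min (x.2 i) (m : ℕ∞)) ∈ Y := by
      filter_upwards [eventually_ge_atTop 1] with m hm
      exact ⟨fun i => le_min (hx1 i) (by exact_mod_cast hm),
        fun a b hab => min_le_min_right _ (hxm hab)⟩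
    obtain ⟨m, hm⟩ := (eventually_mem_inter_Y hU (tendsto_min_natCast x.2) hY).exists
    refine ⟨_, hm, ?_⟩
    simp only [D_comm (F^[_] x)]
    refine liYorke_of_le hm.2.1 rfl (fun i => min_le_left _ _) (j := j) ?_ hj
    exact ne_top_of_le_ne_top (ENat.natCast_ne_top m) (min_le_right _ _)
  · push Not at htop
    have hY : ∀ᶠ m : ℕ in atTop,
        (x.1, fun i : ℕ+ => if (i : ℕ) ≤ m then x.2 i else ⊤) ∈ Y := by
      refine .of_forall fun m => ⟨fun i => ?_, fun a b hab => ?_⟩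
      · dsimp only
        split_ifs
        exacts [hx1 i, le_top]
      · have hab' : (a : ℕ) ≤ b := hab
        dsimp only
        split_ifs
        exacts [hxm hab, le_top, by omega, le_top]
    obtain ⟨m, hm⟩ := (eventually_mem_inter_Y hU (tendsto_ite_le_top x.2) hY).exists
    refine ⟨_, hm, liYorke_of_le hx1 rfl (fun i => ?_) (htop m.succPNat) ?_⟩
    · dsimp only
      split_ifs
      exacts [le_rfl, le_top]
    · simp
end
end

section
/- There exists a compact, pathwise connected metric space Z and a continuous map G : Z → Z such that (Z, G) is Li-Yorke sensitive but every scrambled set of (Z, G) is at most countable; in particular there is a connected compact dynamical system which is Li-Yorke sensitive but not Li-Yorke chaotic. -/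
open Filter Topology

/-- Li-Yorke sensitivity of a self-map of a metric space. -/
def LiYorkeSensitive {X : Type*} [MetricSpace X] (F : X → X) : Prop :=
  ∃ ε : ℝ, 0 < ε ∧ ∀ x : X, ∀ U ∈ nhds x, ∃ y ∈ U,
    liminf (fun n : ℕ => dist (F^[n] x) (F^[n] y)) atTop = 0 ∧
    ε < limsup (fun n : ℕ => dist (F^[n] x) (F^[n] y)) atTop

/-- Scrambled sets of a self-map of a metric space. -/
def IsScrambled {X : Type*} [MetricSpace X] (F : X → X) (S : Set X) : Prop :=
  ∀ x ∈ S, ∀ y ∈ S, x ≠ y →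
    liminf (fun n : ℕ => dist (F^[n] x) (F^[n] y)) atTop = 0 ∧
    ¬ Tendsto (fun n : ℕ => dist (F^[n] x) (F^[n] y)) atTop (nhds 0)

section Cone

open scoped lp ENNReal

/-- The map `s ↦ min 1 (2 s)` of the unit interval. -/
noncomputable def pushUp (s : unitInterval) : unitInterval :=
  ⟨min 1 (2 * (s : ℝ)), le_min zero_le_one (mul_nonneg zero_le_two s.2.1), min_le_left _ _⟩

lemma continuous_pushUp : Continuous pushUp := by
  unfold pushUp
  fun_prop

lemma pushUp_iterate (s : unitInterval) (n : ℕ) :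
    ((pushUp^[n] s : unitInterval) : ℝ) = min (1 : ℝ) (2 ^ n * (s : ℝ)) := by
  induction n with
  | zero => simp [s.2.2]
  | succ n ih =>
    rw [Function.iterate_succ_apply']
    simp only [pushUp, ih, pow_succ]
    rcases le_total (1 : ℝ) (2 ^ n * s) with h | h
    · rw [min_eq_left h, min_eq_left (by norm_num), min_eq_left (by linarith)]
    · rw [min_eq_right h]
      ring_nf

lemma eventually_pushUp_iterate {s : unitInterval} (hs : s ≠ 0) :
    ∀ᶠ n in atTop, pushUp^[n] s = 1 := by
  have hs' : (0 : ℝ) < s := unitInterval.pos_iff_ne_zero.2 hs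
  have h : Tendsto (fun n : ℕ => (2 : ℝ) ^ n * s) atTop atTop :=
    (tendsto_pow_atTop_atTop_of_one_lt one_lt_two).atTop_mul_const hs'
  filter_upwards [h.eventually_ge_atTop 1] with n hn
  ext
  rw [pushUp_iterate, min_eq_left hn]
  rfl

variable {X : Type} [MetricSpace X] [CompactSpace X]

/-- A cone over `X` in which the apex, the segment over `p` and the point `p` of the base are
identified; it is realised inside a Banach space. -/
noncomputable def coneMap (p : X) (q : X × unitInterval) : ℓ^∞(ℕ, ℝ) × ℓ^∞(ℕ, ℝ) :=
  ((q.2 : ℝ) • (kuratowskiEmbedding X q.1 - kuratowskiEmbedding X p),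
    ((q.2 : ℝ) ^ 2) • (kuratowskiEmbedding X q.1 - kuratowskiEmbedding X p))

lemma continuous_coneMap (p : X) : Continuous (coneMap p) := by
  have := (kuratowskiEmbedding.isometry X).continuous
  unfold coneMap
  fun_prop

lemma dist_coneMap_one (p x y : X) : dist (coneMap p (x, 1)) (coneMap p (y, 1)) = dist x y := by
  simp [coneMap, Prod.dist_eq, (kuratowskiEmbedding.isometry X).dist_eq]

lemma coneMap_eq_zero (p : X) {q : X × unitInterval} (hq : q.1 = p ∨ q.2 = 0) :
    coneMap p q = 0 := by
  rcases hq with hq | hq <;> simp [coneMap, hq]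

lemma eq_of_coneMap_eq (p : X) {q r : X × unitInterval} (h : coneMap p q = coneMap p r) :
    ((q.1 = p ∨ q.2 = 0) ∧ (r.1 = p ∨ r.2 = 0)) ∨ q = r := by
  obtain ⟨x, s⟩ := q
  obtain ⟨y, t⟩ := r
  have hinj := (kuratowskiEmbedding.isometry X).injective
  obtain ⟨h1, h2⟩ := Prod.ext_iff.1 h
  simp only [coneMap, pow_two, mul_smul] at h1 h2
  rw [← h1, ← sub_eq_zero, ← sub_smul, smul_eq_zero] at h2
  have key : ∀ (x : X) (s : unitInterval),
      (s : ℝ) • (kuratowskiEmbedding X x - kuratowskiEmbedding X p) = 0 → x = p ∨ s = 0 := by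
    intro x s h
    rcases smul_eq_zero.1 h with h | h
    · exact Or.inr (Subtype.ext h)
    · exact Or.inl (hinj (sub_eq_zero.1 h))
  by_cases h0 : (s : ℝ) • (kuratowskiEmbedding X x - kuratowskiEmbedding X p) = 0
  · exact Or.inl ⟨key x s h0, key y t (h1 ▸ h0)⟩
  · right
    have hst : (s : ℝ) = t := sub_eq_zero.1 (h2.resolve_right h0)
    have hs : (s : ℝ) ≠ 0 := fun hs => h0 (by rw [hs, zero_smul])
    rw [← hst] at h1
    have := hinj (sub_left_injective (smul_right_injective _ hs h1))
    exact Prod.ext this (Subtype.ext hst)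

/-- A compact system with a fixed point which is Li-Yorke sensitive and has only countable
scrambled sets can be replaced by a path connected one. -/
theorem exists_pathConnected_of_liYorkeSensitive {F : X → X} (hF : Continuous F) {p : X}
    (hp : F p = p) (hsens : LiYorkeSensitive F)
    (hcount : ∀ S : Set X, IsScrambled F S → S.Countable) :
    ∃ (Z : Type) (_ : MetricSpace Z) (G : Z → Z), CompactSpace Z ∧ PathConnectedSpace Z ∧
      Continuous G ∧ LiYorkeSensitive G ∧ ∀ S : Set Z, IsScrambled G S → S.Countable := by
  let Z := Set.range (coneMap p)
  let J : C(X × unitInterval, Z) :=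
    ⟨Set.rangeFactorization (coneMap p), (continuous_coneMap p).subtype_mk _⟩
  have hJ : Continuous J := J.continuous
  have hJs : Function.Surjective J := Set.rangeFactorization_surjective
  have hZ : CompactSpace Z := isCompact_iff_compactSpace.1 (isCompact_range (continuous_coneMap p))
  have hJq : IsQuotientMap J := hJ.isClosedMap.isQuotientMap hJ hJs
  have hfac : Function.FactorsThrough (fun q : X × unitInterval => J (F q.1, pushUp q.2)) J := by
    intro q r hqr
    rcases eq_of_coneMap_eq p (congrArg Subtype.val hqr) with ⟨hq, hr⟩ | rfl
    · have h0 : pushUp 0 = 0 := by ext; simp [pushUp]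
      have : ∀ q : X × unitInterval, (q.1 = p ∨ q.2 = 0) →
          coneMap p (F q.1, pushUp q.2) = 0 := by
        intro q hq
        apply coneMap_eq_zero
        rcases hq with hq | hq
        · exact Or.inl (by simp [hq, hp])
        · exact Or.inr (by simp [hq, h0])
      exact Subtype.ext ((this q hq).trans (this r hr).symm)
    · rfl
  let F' : C(X × unitInterval, Z) := ⟨fun q => J (F q.1, pushUp q.2),
    hJ.comp ((hF.comp continuous_fst).prodMk (continuous_pushUp.comp continuous_snd))⟩
  let G : C(Z, Z) := hJq.lift F' hfac
  have hGJ : ∀ q, G (J q) = J (F q.1, pushUp q.2) := fun q =>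
    DFunLike.congr_fun (hJq.lift_comp F' hfac) q
  have hiter : ∀ n x s, G^[n] (J (x, s)) = J (F^[n] x, pushUp^[n] s) := by
    intro n
    induction n with
    | zero => intro x s; rfl
    | succ n ih => intro x s; rw [Function.iterate_succ_apply, hGJ, ih]; rfl
  have hdist : ∀ x s y t, s ≠ 0 → t ≠ 0 → ∀ᶠ n in atTop,
      dist (G^[n] (J (x, s))) (G^[n] (J (y, t))) = dist (F^[n] x) (F^[n] y) := by
    intro x s y t hs ht
    filter_upwards [eventually_pushUp_iterate hs, eventually_pushUp_iterate ht] with n h1 h2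
    rw [hiter, hiter, h1, h2]
    exact dist_coneMap_one p _ _
  have hrep : ∀ z, ∃ x s, s ≠ 0 ∧ J (x, s) = z := by
    intro z
    obtain ⟨⟨x, s⟩, rfl⟩ := hJs z
    by_cases hs : s = 0
    · exact ⟨p, 1, one_ne_zero, Subtype.ext ((coneMap_eq_zero p (Or.inl rfl)).trans
        (coneMap_eq_zero p (Or.inr hs)).symm)⟩
    · exact ⟨x, s, hs, rfl⟩
  refine ⟨Z, inferInstance, G, hZ, ?_, G.continuous, ?_, ?_⟩
  · have hI : PathConnectedSpace unitInterval :=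
      isPathConnected_iff_pathConnectedSpace.1 ((convex_Icc 0 1).isPathConnected ⟨0, by simp⟩)
    have : ∀ x s, Joined (J (p, 1)) (J (x, s)) := by
      intro x s
      have h1 : Joined (0 : unitInterval) s := PathConnectedSpace.joined _ _
      have h2 : Joined (J (x, 0)) (J (x, s)) :=
        ⟨h1.somePath.map (f := fun t => J (x, t)) (by fun_prop)⟩
      have h3 : J (x, 0) = J (p, 1) := Subtype.ext ((coneMap_eq_zero p (Or.inr rfl)).trans
        (coneMap_eq_zero p (Or.inl rfl)).symm)
      exact h3 ▸ h2
    refine ⟨⟨J (p, 1)⟩, fun z w => ?_⟩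
    obtain ⟨⟨x, s⟩, rfl⟩ := hJs z
    obtain ⟨⟨y, t⟩, rfl⟩ := hJs w
    exact (this x s).symm.trans (this y t)
  · obtain ⟨ε, hε, h⟩ := hsens
    refine ⟨ε, hε, fun z U hU => ?_⟩
    obtain ⟨x, s, hs, rfl⟩ := hrep z
    have hc : Continuous fun y => J (y, s) := by fun_prop
    obtain ⟨y, hy, h1, h2⟩ := h x _ (hc.continuousAt.preimage_mem_nhds hU)
    refine ⟨J (y, s), hy, ?_, ?_⟩
    · rw [liminf_congr (hdist x s y s hs hs), h1]
    · rwa [limsup_congr (hdist x s y s hs hs)]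
  · intro S hS
    choose π σ hσ hπ using hrep
    have hinj : Set.InjOn π S := by
      intro z hz w hw hzw
      by_contra hne
      refine (hS z hz w hw hne).2 (tendsto_const_nhds.congr' ?_)
      have := hdist (π z) (σ z) (π w) (σ w) (hσ z) (hσ w)
      rw [hπ, hπ] at this
      filter_upwards [this] with n hn
      rw [hn, hzw, dist_self]
    refine Set.countable_of_injective_of_countable_image hinj (hcount _ ?_)
    rintro _ ⟨z, hz, rfl⟩ _ ⟨w, hw, rfl⟩ hne
    have := hdist (π z) (σ z) (π w) (σ w) (hσ z) (hσ w)
    rw [hπ, hπ] at this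
    have hzw := hS z hz w hw (fun h => hne (congrArg π h))
    rw [← liminf_congr this]
    exact ⟨hzw.1, fun ht => hzw.2 (ht.congr' (this.mono fun _ h => h.symm))⟩

end Cone

section Construction

open scoped PiCountable

attribute [local instance] PiCountable.metricSpace

/-- Labels of the time windows: in a window labelled `none` every point moves its display
coordinate, in a window labelled `some (inl j)` the digit `j` is displayed, and in a window labelled
`some (inr j)` the digit `j` is hidden. -/
abbrev WindowLabel := Option (ℕ ⊕ ℕ)

/-- An enumeration of the labels taking every value infinitely often. -/
def windowLabel (m : ℕ) : WindowLabel := ((Denumerable.eqv (WindowLabel × ℕ)).symm m).1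

/-- The tent function of height `m / (m + 1)` on each window `[m ^ 2, (m + 1) ^ 2)`. -/
noncomputable def level (n : ℕ) : ℝ :=
  (min (n - n.sqrt * n.sqrt) (2 * n.sqrt - (n - n.sqrt * n.sqrt)) : ℕ) / ((n.sqrt : ℝ) + 1)

/-- The amplitude of the display coordinate. -/
def amplitude (l : WindowLabel) (h : ℕ → ℝ) : ℝ :=
  match l with
  | none => 1
  | some (Sum.inl j) => h j
  | some (Sum.inr _) => 0

/-- The factor multiplying the digit `j`. -/
def damping (l : WindowLabel) (b : ℝ) (j : ℕ) : ℝ := if l = some (Sum.inr j) then 1 - b else 1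

/-- The display coordinate and the damped digits of `h` at height `b` of a window labelled `l`. -/
def shape (l : WindowLabel) (b : ℝ) (h : ℕ → ℝ) : ℝ × (ℕ → ℝ) :=
  (b * amplitude l h, fun j => damping l b j * h j)

/-- The position at time `n` of the trajectory with digits `h`. -/
noncomputable def state (n : ℕ) (h : ℕ → ℝ) : ℝ × ℝ × (ℕ → ℝ) :=
  (1 / ((n : ℝ) + 1), shape (windowLabel n.sqrt) (level n) h)

/-- Sequences of binary digits. -/
def binarySeqs : Set (ℕ → ℝ) := {h | ∀ j, h j = 0 ∨ h j = 1}

/-- The closed set of all shapes of binary sequences. -/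
def shapes : Set (ℝ × (ℕ → ℝ)) :=
  {q | q.1 ∈ Set.Icc (0 : ℝ) 1 ∧ (∀ j, q.2 j ∈ Set.Icc (0 : ℝ) 1) ∧
    (∀ i j, i ≠ j → q.2 i * (1 - q.2 i) * (q.2 j * (1 - q.2 j)) = 0) ∧
    ∀ i, q.1 * (q.2 i * (1 - q.2 i)) = 0}

/-- The phase space: all trajectories, together with their limit points. -/
def phaseSpace : Set (ℝ × ℝ × (ℕ → ℝ)) :=
  {x | x.1 = 0 ∧ x.2 ∈ shapes} ∪ ⋃ n, state n '' binarySeqs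

/-- Follow the trajectories, and fix all other points. -/
noncomputable def step : ℝ × ℝ × (ℕ → ℝ) → ℝ × ℝ × (ℕ → ℝ) :=
  Function.extend (fun p : ℕ × (ℕ → ℝ) => state p.1 p.2) (fun p => state (p.1 + 1) p.2) id

lemma level_nonneg (n : ℕ) : 0 ≤ level n := by
  unfold level
  positivity

lemma level_lt_one (n : ℕ) : level n < 1 := by
  unfold level
  rw [div_lt_one (by positivity)]
  have : min (n - n.sqrt * n.sqrt) (2 * n.sqrt - (n - n.sqrt * n.sqrt)) < n.sqrt + 1 := by omega
  exact_mod_cast this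

lemma level_succ (n : ℕ) :
    ((n + 1).sqrt = n.sqrt ∧ |level (n + 1) - level n| ≤ 1 / ((n.sqrt : ℝ) + 1)) ∨
      (level (n + 1) = 0 ∧ level n = 0) := by
  have h1 := Nat.sqrt_le n
  have h2 := Nat.lt_succ_sqrt n
  obtain ⟨m, hm⟩ : ∃ m, m = n.sqrt := ⟨_, rfl⟩
  obtain ⟨k, hk⟩ : ∃ k, n = m * m + k := ⟨n - m * m, by subst hm; omega⟩
  rw [← hm] at h1 h2
  have hk2 : k ≤ 2 * m := by
    rw [hk] at h2
    nlinarith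
  rcases hk2.lt_or_eq with hlt | heq
  · have hs : (n + 1).sqrt = m := by
      rw [hk, add_assoc]
      exact Nat.sqrt_add_eq m (by omega)
    refine Or.inl ⟨hs.trans hm, ?_⟩
    unfold level
    rw [hs, ← hm, ← sub_div, abs_div, abs_of_pos (by positivity : (0 : ℝ) < (m : ℝ) + 1)]
    gcongr
    have e1 : n + 1 - m * m = k + 1 := by omega
    have e2 : n - m * m = k := by omega
    rw [e1, e2]
    have h3 : |((min (k + 1) (2 * m - (k + 1)) : ℕ) : ℤ) - (min k (2 * m - k) : ℕ)| ≤ 1 := by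
      rw [abs_le]
      omega
    exact_mod_cast h3
  · have hs : (n + 1).sqrt = m + 1 := by
      have : n + 1 = (m + 1) * (m + 1) := by rw [hk, heq]; ring
      rw [this, Nat.sqrt_eq]
    right
    unfold level
    have e1 : n + 1 - (m + 1) * (m + 1) = 0 := by
      rw [hk, heq, Nat.sub_eq_zero_iff_le]
      nlinarith
    have e2 : n - m * m = 2 * m := by omega
    rw [hs, ← hm, e1, e2]
    simp

lemma level_add {m k : ℕ} (hk : k ≤ m) :
    (m * m + k).sqrt = m ∧ level (m * m + k) = k / ((m : ℝ) + 1) := by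
  have hs : (m * m + k).sqrt = m := Nat.sqrt_add_eq m (by omega)
  refine ⟨hs, ?_⟩
  unfold level
  rw [hs, Nat.add_sub_cancel_left, min_eq_left (by omega)]

lemma amplitude_mem {h : ℕ → ℝ} (hh : h ∈ binarySeqs) (l : WindowLabel) :
    amplitude l h ∈ Set.Icc (0 : ℝ) 1 := by
  rcases l with _ | j | j
  · simp [amplitude]
  · rcases hh j with h0 | h0 <;> simp [amplitude, h0]
  · simp [amplitude]

lemma damping_pos (l : WindowLabel) {b : ℝ} (hb : b < 1) (j : ℕ) : 0 < damping l b j := by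
  unfold damping
  split_ifs <;> linarith

lemma shape_mem_shapes {h : ℕ → ℝ} (hh : h ∈ binarySeqs) (l : WindowLabel) {b : ℝ}
    (hb : b ∈ Set.Icc (0 : ℝ) 1) : shape l b h ∈ shapes := by
  obtain ⟨hb0, hb1⟩ := hb
  obtain ⟨ha0, ha1⟩ := amplitude_mem hh l
  have hval : ∀ j, l ≠ some (Sum.inr j) → (shape l b h).2 j * (1 - (shape l b h).2 j) = 0 := by
    intro j hj
    rcases hh j with h0 | h0 <;> simp [shape, damping, hj, h0]
  refine ⟨⟨mul_nonneg hb0 ha0, mul_le_one₀ hb1 ha0 ha1⟩, fun j => ?_, fun i j hij => ?_,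
    fun i => ?_⟩
  · simp only [shape, damping]
    rcases hh j with h0 | h0 <;> rw [h0] <;> split_ifs <;> constructor <;> linarith
  · by_cases hi : l = some (Sum.inr i)
    · rw [hval j (by rw [hi]; simpa using hij), mul_zero]
    · rw [hval i hi, zero_mul]
  · by_cases hi : l = some (Sum.inr i)
    · simp [hi, shape, amplitude]
    · rw [hval i hi, mul_zero]

lemma exists_shape_eq {q : ℝ × (ℕ → ℝ)} (hq : q ∈ shapes) :
    ∃ l, ∃ b ∈ Set.Icc (0 : ℝ) 1, ∃ h ∈ binarySeqs, shape l b h = q := by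
  obtain ⟨c, u⟩ := q
  obtain ⟨hc, hu, hij, hci⟩ := hq
  simp only at hc hu hij hci
  by_cases hall : ∀ i, u i * (1 - u i) = 0
  · refine ⟨none, c, hc, u, fun j => ?_, ?_⟩
    · rcases mul_eq_zero.1 (hall j) with h | h
      · exact Or.inl h
      · exact Or.inr (by linarith)
    · simp [shape, amplitude, damping]
  · push Not at hall
    obtain ⟨i, hi⟩ := hall
    have hc0 : c = 0 := (mul_eq_zero.1 (hci i)).resolve_right hi
    refine ⟨some (Sum.inr i), 1 - u i, ⟨by linarith [(hu i).2], by linarith [(hu i).1]⟩,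
      Function.update u i 1, fun j => ?_, ?_⟩
    · rcases eq_or_ne j i with rfl | hj
      · simp
      · rw [Function.update_of_ne hj]
        rcases mul_eq_zero.1 ((mul_eq_zero.1 (hij i j hj.symm)).resolve_left hi) with h | h
        · exact Or.inl h
        · exact Or.inr (by linarith)
    · refine Prod.ext (by simp [shape, amplitude, hc0]) (funext fun j => ?_)
      rcases eq_or_ne j i with rfl | hj
      · simp [shape, damping]
      · simp [shape, damping, hj, hj.symm]

lemma continuous_shape_level (l : WindowLabel) (h : ℕ → ℝ) : Continuous fun b => shape l b h := by
  have : ∀ j, Continuous fun b => damping l b j := by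
    intro j
    unfold damping
    split_ifs <;> fun_prop
  unfold shape
  fun_prop

lemma continuous_state (n : ℕ) : Continuous (state n) := by
  have : ∀ l, Continuous (amplitude l) := by
    rintro (_ | j | j) <;> unfold amplitude <;> fun_prop
  unfold state shape
  fun_prop

lemma state_injective : Function.Injective fun p : ℕ × (ℕ → ℝ) => state p.1 p.2 := by
  rintro ⟨n, h⟩ ⟨n', h'⟩ heq
  obtain ⟨h1, h2⟩ := Prod.ext_iff.1 heq
  have hn : n = n' := by
    simpa [state] using h1
  subst hn
  refine Prod.ext rfl (funext fun j => ?_)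
  have h3 := congrFun (Prod.ext_iff.1 h2).2 j
  exact mul_left_cancel₀ (damping_pos _ (level_lt_one n) j).ne' h3

lemma step_state (n : ℕ) (h : ℕ → ℝ) : step (state n h) = state (n + 1) h :=
  state_injective.extend_apply _ _ (n, h)

lemma state_fst_pos (n : ℕ) (h : ℕ → ℝ) : 0 < (state n h).1 := by
  simp only [state]
  positivity

lemma step_of_fst_eq_zero {x : ℝ × ℝ × (ℕ → ℝ)} (hx : x.1 = 0) : step x = x := by
  refine Function.extend_apply' _ _ _ ?_
  rintro ⟨⟨n, h⟩, rfl⟩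
  exact (state_fst_pos n h).ne' hx

lemma state_mem_phaseSpace (n : ℕ) {h : ℕ → ℝ} (hh : h ∈ binarySeqs) : state n h ∈ phaseSpace :=
  Or.inr (Set.mem_iUnion.2 ⟨n, h, hh, rfl⟩)

lemma mapsTo_step : Set.MapsTo step phaseSpace phaseSpace := by
  rintro x (hx | hx)
  · rw [step_of_fst_eq_zero hx.1]
    exact Or.inl hx
  · obtain ⟨n, h, hh, rfl⟩ := Set.mem_iUnion.1 hx
    rw [step_state]
    exact state_mem_phaseSpace _ hh

lemma isCompact_binarySeqs : IsCompact binarySeqs := by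
  have h : binarySeqs = Set.pi Set.univ fun _ => ({0, 1} : Set ℝ) := by
    ext h
    simp [binarySeqs]
  rw [h]
  exact isCompact_univ_pi fun _ => (Set.toFinite _).isCompact

lemma isClosed_shapes : IsClosed shapes := by
  have h : shapes = {q : ℝ × (ℕ → ℝ) | q.1 ∈ Set.Icc (0 : ℝ) 1} ∩
      ((⋂ j, {q : ℝ × (ℕ → ℝ) | q.2 j ∈ Set.Icc (0 : ℝ) 1}) ∩
      ((⋂ i, ⋂ j, ⋂ _ : i ≠ j,
        {q : ℝ × (ℕ → ℝ) | q.2 i * (1 - q.2 i) * (q.2 j * (1 - q.2 j)) = 0}) ∩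
      ⋂ i, {q : ℝ × (ℕ → ℝ) | q.1 * (q.2 i * (1 - q.2 i)) = 0})) := by
    ext q
    simp only [shapes, Set.mem_inter_iff, Set.mem_iInter, Set.mem_ofPred_eq]
  rw [h]
  refine (isClosed_Icc.preimage continuous_fst).inter (IsClosed.inter ?_ (IsClosed.inter ?_ ?_))
  · exact isClosed_iInter fun j => isClosed_Icc.preimage
      ((continuous_apply j).comp continuous_snd)
  · exact isClosed_iInter fun i => isClosed_iInter fun j => isClosed_iInter fun _ =>
      isClosed_eq (by fun_prop) continuous_const
  · exact isClosed_iInter fun i => isClosed_eq (by fun_prop) continuous_const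

lemma snd_mem_shapes {x : ℝ × ℝ × (ℕ → ℝ)} (hx : x ∈ phaseSpace) : x.2 ∈ shapes := by
  rcases hx with hx | hx
  · exact hx.2
  · obtain ⟨n, h, hh, rfl⟩ := Set.mem_iUnion.1 hx
    exact shape_mem_shapes hh _ ⟨level_nonneg n, (level_lt_one n).le⟩

lemma isClosed_phaseSpace : IsClosed phaseSpace := by
  have h : phaseSpace = ⋂ n : ℕ, ((Set.Icc (0 : ℝ) (1 / ((n : ℝ) + 1)) ×ˢ shapes) ∪
      ⋃ i ∈ Set.Iio n, state i '' binarySeqs) := by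
    ext x
    constructor
    · rintro hx
      refine Set.mem_iInter.2 fun n => ?_
      rcases id hx with hx' | hx'
      · exact Or.inl ⟨by rw [hx'.1]; exact ⟨le_rfl, by positivity⟩, hx'.2⟩
      · obtain ⟨i, h, hh, rfl⟩ := Set.mem_iUnion.1 hx'
        rcases lt_or_ge i n with hi | hi
        · exact Or.inr (Set.mem_biUnion hi ⟨h, hh, rfl⟩)
        · refine Or.inl ⟨⟨(state_fst_pos i h).le, ?_⟩, snd_mem_shapes hx⟩
          exact one_div_le_one_div_of_le (by positivity) (by gcongr)
    · intro hx
      by_cases hi : ∃ i, x ∈ state i '' binarySeqs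
      · exact Or.inr (Set.mem_iUnion.2 hi)
      · have h' : ∀ n : ℕ, x ∈ Set.Icc (0 : ℝ) (1 / ((n : ℝ) + 1)) ×ˢ shapes := by
          intro n
          refine (Set.mem_iInter.1 hx n).resolve_right fun h => hi ?_
          obtain ⟨i, _, hi⟩ := Set.mem_iUnion₂.1 h
          exact ⟨i, hi⟩
        refine Or.inl ⟨le_antisymm ?_ (h' 0).1.1, (h' 0).2⟩
        exact ge_of_tendsto' tendsto_one_div_add_atTop_nhds_zero_nat fun n => (h' n).1.2
  rw [h]
  refine isClosed_iInter fun n => (isClosed_Icc.prod isClosed_shapes).union ?_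
  exact (Set.finite_Iio n).isClosed_biUnion fun i _ =>
    (isCompact_binarySeqs.image (continuous_state i)).isClosed

lemma isCompact_phaseSpace : IsCompact phaseSpace := by
  refine (isCompact_Icc.prod (isCompact_Icc.prod (isCompact_univ_pi fun _ => isCompact_Icc))
    : IsCompact (Set.Icc (0 : ℝ) 1 ×ˢ (Set.Icc (0 : ℝ) 1 ×ˢ
      Set.pi Set.univ fun _ : ℕ => Set.Icc (0 : ℝ) 1))).of_isClosed_subset isClosed_phaseSpace ?_
  intro x hx
  have h2 := snd_mem_shapes hx
  refine ⟨?_, h2.1, fun j _ => h2.2.1 j⟩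
  rcases hx with hx | hx
  · rw [hx.1]
    exact ⟨le_rfl, zero_le_one⟩
  · obtain ⟨n, h, hh, rfl⟩ := Set.mem_iUnion.1 hx
    refine ⟨(state_fst_pos n h).le, ?_⟩
    simp only [state]
    rw [div_le_one (by positivity)]
    linarith [n.cast_nonneg (α := ℝ)]

lemma shape_sub_le {h : ℕ → ℝ} (hh : h ∈ binarySeqs) (l : WindowLabel) (b b' : ℝ) :
    |(shape l b h).1 - (shape l b' h).1| ≤ |b - b'| ∧
      ∀ j, |(shape l b h).2 j - (shape l b' h).2 j| ≤ |b - b'| := by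
  obtain ⟨ha0, ha1⟩ := amplitude_mem hh l
  constructor
  · simp only [shape]
    rw [← sub_mul, abs_mul, abs_of_nonneg ha0]
    exact mul_le_of_le_one_right (abs_nonneg _) ha1
  · intro j
    simp only [shape, damping]
    rw [abs_sub_comm b b']
    rcases hh j with h0 | h0 <;> rw [h0] <;> split_ifs <;> simp

lemma shape_zero (l : WindowLabel) (h : ℕ → ℝ) : shape l 0 h = (0, h) := by
  simp [shape, damping]

lemma step_sub_le {x : ℝ × ℝ × (ℕ → ℝ)} (hx : x ∈ phaseSpace) :
    |(step x).1 - x.1| ≤ √x.1 ∧ |(step x).2.1 - x.2.1| ≤ √x.1 ∧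
      ∀ j, |(step x).2.2 j - x.2.2 j| ≤ √x.1 := by
  rcases hx with hx | hx
  · rw [step_of_fst_eq_zero hx.1]
    simp [Real.sqrt_nonneg]
  · obtain ⟨n, h, hh, rfl⟩ := Set.mem_iUnion.1 hx
    rw [step_state]
    refine ⟨?_, ?_⟩
    · have hn : (0 : ℝ) ≤ n := n.cast_nonneg
      have h1 : 1 / ((n : ℝ) + 1) ≤ 1 := by
        rw [div_le_one (by positivity)]
        linarith
      have h2 : 1 / (((n + 1 : ℕ) : ℝ) + 1) ≤ 1 / ((n : ℝ) + 1) := by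
        push_cast
        gcongr
        linarith
      have h3 : (0 : ℝ) < 1 / (((n + 1 : ℕ) : ℝ) + 1) := by positivity
      simp only [state]
      have h4 : 1 / ((n : ℝ) + 1) ≤ √(1 / ((n : ℝ) + 1)) :=
        Real.le_sqrt_of_sq_le (by nlinarith)
      rw [abs_le]
      constructor <;> linarith
    · rcases level_succ n with ⟨hs, hl⟩ | ⟨h0, h1⟩
      · have hb : |level (n + 1) - level n| ≤ √(state n h).1 := by
          refine hl.trans (Real.le_sqrt_of_sq_le ?_)
          simp only [state]
          rw [div_pow, one_pow]
          apply one_div_le_one_div_of_le (by positivity)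
          have := Nat.lt_succ_sqrt n
          have h5 : n + 1 ≤ (n.sqrt + 1) ^ 2 := by rw [pow_two]; exact this
          exact_mod_cast h5
        obtain ⟨h1, h2⟩ := shape_sub_le hh (windowLabel n.sqrt) (level (n + 1)) (level n)
        simp only [state, hs] at hb ⊢
        exact ⟨h1.trans hb, fun j => (h2 j).trans hb⟩
      · simp [state, h0, h1, shape_zero, Real.sqrt_nonneg]

lemma continuousOn_step : ContinuousOn step phaseSpace := by
  intro x hx
  rcases id hx with hx' | hx'
  · have hsq : Tendsto (fun y : ℝ × ℝ × (ℕ → ℝ) => √y.1) (𝓝[phaseSpace] x) (𝓝 0) := by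
      have : Continuous fun y : ℝ × ℝ × (ℕ → ℝ) => √y.1 := by fun_prop
      have h := this.continuousAt (x := x)
      rw [ContinuousAt, hx'.1, Real.sqrt_zero] at h
      exact h.mono_left nhdsWithin_le_nhds
    have key : ∀ f : ℝ × ℝ × (ℕ → ℝ) → ℝ, Continuous f →
        (∀ y ∈ phaseSpace, |f (step y) - f y| ≤ √y.1) →
        Tendsto (fun y => f (step y)) (𝓝[phaseSpace] x) (𝓝 (f x)) := by
      intro f hf hle
      have h1 : Tendsto (fun y => f (step y) - f y) (𝓝[phaseSpace] x) (𝓝 0) :=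
        squeeze_zero_norm' (by filter_upwards [self_mem_nhdsWithin] with y hy using hle y hy) hsq
      have h2 := h1.add (hf.continuousAt.mono_left nhdsWithin_le_nhds : Tendsto f _ (𝓝 (f x)))
      simpa using h2
    rw [ContinuousWithinAt, step_of_fst_eq_zero hx'.1]
    refine Tendsto.prodMk_nhds (key _ continuous_fst fun y hy => (step_sub_le hy).1)
      (Tendsto.prodMk_nhds (key (fun y => y.2.1) (by fun_prop) fun y hy => (step_sub_le hy).2.1)
        (tendsto_pi_nhds.2 fun j => key (fun y => y.2.2 j) (by fun_prop)
          fun y hy => (step_sub_le hy).2.2 j))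
  · obtain ⟨n, h, hh, rfl⟩ := Set.mem_iUnion.1 hx'
    let f : ℝ × ℝ × (ℕ → ℝ) → ℝ × ℝ × (ℕ → ℝ) := fun y =>
      state (n + 1) fun j => y.2.2 j / damping (windowLabel n.sqrt) (level n) j
    have hf : Continuous f := (continuous_state (n + 1)).comp (by fun_prop)
    have hfs : ∀ h, f (state n h) = step (state n h) := by
      intro h
      rw [step_state]
      simp only [f]
      congr 1
      funext j
      exact mul_div_cancel_left₀ _ (damping_pos _ (level_lt_one n) j).ne'
    have hinv : ContinuousAt (fun y : ℝ × ℝ × (ℕ → ℝ) => y.1⁻¹) (state n h) :=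
      continuousAt_fst.inv₀ (state_fst_pos n h).ne'
    have hev : f =ᶠ[𝓝[phaseSpace] (state n h)] step := by
      filter_upwards [self_mem_nhdsWithin, mem_nhdsWithin_of_mem_nhds
        (continuousAt_fst.eventually_ne (state_fst_pos n h).ne'),
        mem_nhdsWithin_of_mem_nhds (hinv (Metric.ball_mem_nhds _ one_pos))] with y hy hy0 hy1
      rcases hy with hy | hy
      · exact absurd hy.1 hy0
      · obtain ⟨n', h', hh', rfl⟩ := Set.mem_iUnion.1 hy
        have hlt : |((n' : ℤ) : ℝ) - (n : ℤ)| < 1 := by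
          simpa [state, Real.dist_eq] using hy1
        have : n' = n := by
          have h6 : |(n' : ℤ) - n| < 1 := by exact_mod_cast hlt
          rw [Int.abs_lt_one_iff] at h6
          omega
        rw [this]
        exact hfs h'
    exact (hf.continuousWithinAt.congr_of_eventuallyEq hev.symm (hfs h).symm)

/-- The dynamics on the phase space. -/
noncomputable def phaseMap : phaseSpace → phaseSpace := mapsTo_step.restrict

lemma continuous_phaseMap : Continuous phaseMap := continuousOn_step.mapsToRestrict mapsTo_step

lemma phaseMap_iterate_state (n : ℕ) {h : ℕ → ℝ} (hh : h ∈ binarySeqs) (k : ℕ) :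
    ((phaseMap^[k] ⟨state n h, state_mem_phaseSpace n hh⟩ : phaseSpace) : ℝ × ℝ × (ℕ → ℝ)) =
      state (n + k) h := by
  induction k with
  | zero => rfl
  | succ k ih =>
    rw [Function.iterate_succ_apply', phaseMap, Set.MapsTo.val_restrict_apply]
    erw [ih]
    rw [step_state, add_assoc]

lemma phaseMap_of_fst_eq_zero {x : phaseSpace} (hx : x.1.1 = 0) : phaseMap x = x :=
  Subtype.ext (step_of_fst_eq_zero hx)

/-- Every shape with a given label and height is approached simultaneously by all trajectories
along the same sequence of times. -/
lemma exists_tendsto_state (l : WindowLabel) {b : ℝ} (hb : b ∈ Set.Icc (0 : ℝ) 1) :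
    ∃ N : ℕ → ℕ, Tendsto N atTop atTop ∧
      ∀ h, Tendsto (fun k => state (N k) h) atTop (𝓝 (0, shape l b h)) := by
  obtain ⟨hb0, hb1⟩ := hb
  let m : ℕ → ℕ := fun k => Denumerable.eqv (WindowLabel × ℕ) (l, k)
  have hm : Tendsto m atTop atTop := by
    rw [← Nat.cofinite_eq_atTop]
    exact Function.Injective.tendsto_cofinite
      ((Equiv.injective _).comp (Prod.mk_right_injective l))
  have hlab : ∀ k, windowLabel (m k) = l := fun k => by simp [windowLabel, m]
  have hmR : Tendsto (fun k => (m k : ℝ)) atTop atTop := tendsto_natCast_atTop_atTop.comp hm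
  let N : ℕ → ℕ := fun k => m k * m k + ⌊b * m k⌋₊
  have hfl : ∀ k, ⌊b * m k⌋₊ ≤ m k := fun k =>
    Nat.floor_le_of_le (mul_le_of_le_one_left (Nat.cast_nonneg _) hb1)
  have hN : Tendsto N atTop atTop :=
    tendsto_atTop_mono (fun k => (Nat.le_mul_self _).trans (Nat.le_add_right _ _)) hm
  have hlev : Tendsto (fun k => level (N k)) atTop (𝓝 b) := by
    have h1 := (tendsto_nat_floor_mul_div_atTop hb0).comp hmR
    have h2 := (tendsto_natCast_div_add_atTop (1 : ℝ)).comp hm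
    have h3 := h1.mul h2
    rw [mul_one] at h3
    refine h3.congr' ?_
    filter_upwards [hmR.eventually_gt_atTop 0] with k hk
    rw [(level_add (hfl k)).2]
    simp only [Function.comp]
    field_simp
  refine ⟨N, hN, fun h => Tendsto.prodMk_nhds
    (tendsto_one_div_add_atTop_nhds_zero_nat.comp hN) ?_⟩
  have hshape := ((continuous_shape_level l h).tendsto b).comp hlev
  refine hshape.congr fun k => ?_
  simp only [Function.comp, (level_add (hfl k)).1, hlab, N]

instance : CompactSpace phaseSpace := isCompact_iff_compactSpace.1 isCompact_phaseSpace

/-- If two orbits are, up to a common time shift, given by sequences converging along the same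
times, then the distance of the limits lies between the lower and upper limit of distances. -/
lemma liminf_le_dist_le_limsup {x y : phaseSpace} (c c' : ℕ → ℝ × ℝ × (ℕ → ℝ)) (n : ℕ)
    (hx : ∀ k, ((phaseMap^[k] x : phaseSpace) : ℝ × ℝ × (ℕ → ℝ)) = c (n + k))
    (hy : ∀ k, ((phaseMap^[k] y : phaseSpace) : ℝ × ℝ × (ℕ → ℝ)) = c' (n + k))
    {N : ℕ → ℕ} (hN : Tendsto N atTop atTop) {p q : ℝ × ℝ × (ℕ → ℝ)}
    (hp : Tendsto (c ∘ N) atTop (𝓝 p)) (hq : Tendsto (c' ∘ N) atTop (𝓝 q)) :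
    liminf (fun k : ℕ => dist (phaseMap^[k] x) (phaseMap^[k] y)) atTop ≤ dist p q ∧
      dist p q ≤ limsup (fun k : ℕ => dist (phaseMap^[k] x) (phaseMap^[k] y)) atTop := by
  set a : ℕ → ℝ := fun k => dist (phaseMap^[k] x) (phaseMap^[k] y)
  have hM : Tendsto (fun k => N k - n) atTop atTop := (tendsto_sub_atTop_nat n).comp hN
  have ha : Tendsto (fun k => a (N k - n)) atTop (𝓝 (dist p q)) := by
    refine (hp.dist hq).congr' ?_
    filter_upwards [hN.eventually_ge_atTop n] with k hk
    simp only [a, Subtype.dist_eq, hx, hy, Function.comp, Nat.add_sub_cancel' hk]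
  have hlow : IsBoundedUnder (· ≥ ·) atTop a := isBoundedUnder_of ⟨0, fun k => dist_nonneg⟩
  have hupp : IsBoundedUnder (· ≤ ·) atTop a := isBoundedUnder_of
    ⟨Metric.diam (Set.univ : Set phaseSpace), fun k =>
      Metric.dist_le_diam_of_mem isCompact_univ.isBounded (Set.mem_univ _) (Set.mem_univ _)⟩
  constructor
  · refine le_of_forall_gt_imp_ge_of_dense fun d hd => ?_
    exact liminf_le_of_frequently_le
      (hM.frequently (ha.eventually_le_const hd).frequently) hlow
  · refine le_of_forall_lt_imp_le_of_dense fun d hd => ?_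
    exact le_limsup_of_frequently_le
      (hM.frequently (ha.eventually_const_le hd).frequently) hupp

lemma liminf_dist_nonneg (x y : phaseSpace) :
    0 ≤ liminf (fun k : ℕ => dist (phaseMap^[k] x) (phaseMap^[k] y)) atTop := by
  refine le_liminf_of_le ?_ (Eventually.of_forall fun k => dist_nonneg)
  exact (isBoundedUnder_of ⟨Metric.diam (Set.univ : Set phaseSpace), fun k =>
      Metric.dist_le_diam_of_mem isCompact_univ.isBounded (Set.mem_univ _)
        (Set.mem_univ _)⟩ : IsBoundedUnder (· ≤ ·) atTop _).isCoboundedUnder_ge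

lemma abs_display_sub_le_dist (p q : ℝ × ℝ × (ℕ → ℝ)) : |p.2.1 - q.2.1| ≤ dist p q :=
  (le_max_left _ _ : dist p.2.1 q.2.1 ≤ dist p.2 q.2).trans (le_max_right _ _)

lemma min_le_dist_of_digit (p q : ℝ × ℝ × (ℕ → ℝ)) (j : ℕ) :
    min ((2 : ℝ)⁻¹ ^ j) |p.2.2 j - q.2.2 j| ≤ dist p q :=
  (PiCountable.min_dist_le_dist_pi p.2.2 q.2.2 j).trans
    ((le_max_right _ _ : dist p.2.2 q.2.2 ≤ dist p.2 q.2).trans (le_max_right _ _))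

/-- Change the digit `j`. -/
def flipDigit (h : ℕ → ℝ) (j : ℕ) : ℕ → ℝ := Function.update h j (1 - h j)

lemma flipDigit_mem {h : ℕ → ℝ} (hh : h ∈ binarySeqs) (j : ℕ) : flipDigit h j ∈ binarySeqs := by
  intro i
  rcases eq_or_ne i j with rfl | hij
  · rcases hh i with h0 | h0 <;> simp [flipDigit, h0]
  · simpa [flipDigit, hij] using hh i

lemma eq_flipDigit {h h' : ℕ → ℝ} (hh : h ∈ binarySeqs) (hh' : h' ∈ binarySeqs) {j : ℕ}
    (hj : h j ≠ h' j) (heq : ∀ i, i ≠ j → h i = h' i) : h' = flipDigit h j := by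
  funext i
  rcases eq_or_ne i j with rfl | hij
  · rcases hh i with h0 | h0 <;> rcases hh' i with h1 | h1 <;> simp_all [flipDigit]
  · simp [flipDigit, hij, heq i hij]

lemma tendsto_flipDigit (h : ℕ → ℝ) : Tendsto (flipDigit h) atTop (𝓝 h) := by
  refine tendsto_pi_nhds.2 fun i => tendsto_const_nhds.congr' ?_
  filter_upwards [eventually_gt_atTop i] with j hj
  simp [flipDigit, hj.ne]

/-- Trajectories whose sequences of digits differ at two places are never close. -/
lemma le_dist_state {h h' : ℕ → ℝ} (hh : h ∈ binarySeqs) (hh' : h' ∈ binarySeqs) {i j : ℕ}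
    (hij : i ≠ j) (hi : h i ≠ h' i) (hj : h j ≠ h' j) (n : ℕ) :
    min ((2 : ℝ)⁻¹ ^ i) ((2 : ℝ)⁻¹ ^ j) ≤ dist (state n h) (state n h') := by
  have key : ∀ k, h k ≠ h' k → windowLabel n.sqrt ≠ some (Sum.inr k) →
      (2 : ℝ)⁻¹ ^ k ≤ dist (state n h) (state n h') := by
    intro k hk hl
    have h1 : |(state n h).2.2 k - (state n h').2.2 k| = 1 := by
      simp only [state, shape, damping, if_neg hl, one_mul]
      rcases hh k with h0 | h0 <;> rcases hh' k with h1 | h1 <;> simp_all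
    have h2 := min_le_dist_of_digit (state n h) (state n h') k
    rwa [h1, min_eq_left (pow_le_one₀ (by norm_num) (by norm_num))] at h2
  by_cases hl : windowLabel n.sqrt = some (Sum.inr i)
  · exact (min_le_right _ _).trans (key j hj (by rw [hl]; simpa using hij))
  · exact (min_le_left _ _).trans (key i hi hl)

theorem liYorkeSensitive_phaseMap : LiYorkeSensitive phaseMap := by
  refine ⟨1 / 4, by norm_num, fun x U hU => ?_⟩
  obtain ⟨x, hx⟩ := x
  have h01 : (1 : ℝ) ∈ Set.Icc (0 : ℝ) 1 := ⟨zero_le_one, le_rfl⟩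
  rcases id hx with hx' | hx'
  · obtain ⟨hx0, hxs⟩ := hx'
    obtain ⟨l, b, hb, h, hh, hs⟩ := exists_shape_eq hxs
    have hxeq : (0, shape l b h) = x := Prod.ext hx0.symm hs
    obtain ⟨N, hN, hlim⟩ := exists_tendsto_state l hb
    have hlim' : Tendsto (fun k => (⟨state (N k) h, state_mem_phaseSpace (N k) hh⟩ : phaseSpace))
        atTop (𝓝 ⟨x, hx⟩) := tendsto_subtype_rng.2 (hxeq ▸ hlim h)
    obtain ⟨k, hk⟩ := (hlim'.eventually hU).exists
    have hfix : ∀ i, ((phaseMap^[i] ⟨x, hx⟩ : phaseSpace) : ℝ × ℝ × (ℕ → ℝ)) =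
        (fun _ => x) (N k + i) := fun i => by
      rw [Function.iterate_fixed (phaseMap_of_fst_eq_zero hx0)]
    have horb := phaseMap_iterate_state (N k) hh
    refine ⟨_, hk, le_antisymm ?_ (liminf_dist_nonneg _ _), ?_⟩
    · have h1 := (liminf_le_dist_le_limsup (fun _ => x) (state · h) (N k) hfix horb hN tendsto_const_nhds (hlim h)).1
      rwa [hxeq, dist_self] at h1
    · have hfar : ∀ b ∈ Set.Icc (0 : ℝ) 1, |x.2.1 - b| ≤
          limsup (fun i : ℕ => dist (phaseMap^[i] ⟨x, hx⟩)
            (phaseMap^[i] ⟨state (N k) h, state_mem_phaseSpace (N k) hh⟩)) atTop := by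
        intro b hb
        obtain ⟨M, hM, hMlim⟩ := exists_tendsto_state none hb
        have h2 := (liminf_le_dist_le_limsup (fun _ => x) (state · h) (N k) hfix horb hM tendsto_const_nhds (hMlim h)).2
        refine le_trans ?_ h2
        simpa [shape, amplitude] using abs_display_sub_le_dist x (0, shape none b h)
      have h3 := hfar 0 ⟨le_rfl, zero_le_one⟩
      have h4 := hfar 1 h01
      have h5 := le_abs_self (x.2.1 - 0)
      have h6 := neg_abs_le (x.2.1 - 1)
      linarith
  · obtain ⟨n, h, hh, rfl⟩ := Set.mem_iUnion.1 hx'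
    have hlim : Tendsto (fun j => (⟨state n (flipDigit h j),
        state_mem_phaseSpace n (flipDigit_mem hh j)⟩ : phaseSpace)) atTop (𝓝 ⟨state n h, hx⟩) :=
      tendsto_subtype_rng.2 (((continuous_state n).tendsto h).comp (tendsto_flipDigit h))
    obtain ⟨j, hj⟩ := (hlim.eventually hU).exists
    have horb := phaseMap_iterate_state n hh
    have horb' := phaseMap_iterate_state n (flipDigit_mem hh j)
    refine ⟨_, hj, le_antisymm ?_ (liminf_dist_nonneg _ _), ?_⟩
    · obtain ⟨N, hN, hNlim⟩ := exists_tendsto_state (some (Sum.inr j)) h01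
      have h1 := (liminf_le_dist_le_limsup (state · h) (state · (flipDigit h j)) n
        horb horb' hN (hNlim _) (hNlim _)).1
      have h2 : shape (some (Sum.inr j)) 1 h = shape (some (Sum.inr j)) 1 (flipDigit h j) := by
        refine Prod.ext (by simp [shape, amplitude]) (funext fun i => ?_)
        rcases eq_or_ne i j with rfl | hij
        · simp [shape, damping]
        · simp [shape, flipDigit, hij]
      rwa [h2, dist_self] at h1
    · obtain ⟨N, hN, hNlim⟩ := exists_tendsto_state (some (Sum.inl j)) h01
      have h1 := (liminf_le_dist_le_limsup (state · h) (state · (flipDigit h j)) n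
        horb horb' hN (hNlim _) (hNlim _)).2
      have h2 := abs_display_sub_le_dist (0, shape (some (Sum.inl j)) 1 h)
        (0, shape (some (Sum.inl j)) 1 (flipDigit h j))
      have h3 : |h j - (1 - h j)| = 1 := by
        rcases hh j with h0 | h0 <;> simp [h0]
      simp only [shape, amplitude, flipDigit, Function.update_self, one_mul] at h1 h2
      rw [h3] at h2
      simp only [flipDigit]
      linarith

theorem countable_of_isScrambled_phaseMap (S : Set phaseSpace) (hS : IsScrambled phaseMap S) :
    S.Countable := by
  have hcover : S ⊆ {x | x ∈ S ∧ x.1.1 = 0} ∪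
      ⋃ n, {x | x ∈ S ∧ ∃ h ∈ binarySeqs, x.1 = state n h} := by
    rintro ⟨x, hx⟩ hxS
    rcases id hx with hx' | hx'
    · exact Or.inl ⟨hxS, hx'.1⟩
    · obtain ⟨n, h, hh, rfl⟩ := Set.mem_iUnion.1 hx'
      exact Or.inr (Set.mem_iUnion.2 ⟨n, hxS, h, hh, rfl⟩)
  refine Set.Countable.mono hcover (Set.Countable.union ?_ (Set.countable_iUnion fun n => ?_))
  · refine Set.Subsingleton.countable ?_
    rintro x ⟨hx, hx0⟩ y ⟨hy, hy0⟩
    by_contra hne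
    have h := (hS x hx y hy hne).1
    simp only [Function.iterate_fixed (phaseMap_of_fst_eq_zero hx0),
      Function.iterate_fixed (phaseMap_of_fst_eq_zero hy0), liminf_const] at h
    exact hne (dist_eq_zero.1 h)
  · rcases Set.eq_empty_or_nonempty {x | x ∈ S ∧ ∃ h ∈ binarySeqs, x.1 = state n h} with
      he | ⟨x, hxS, h, hh, hx⟩
    · rw [he]
      exact Set.countable_empty
    · refine Set.Countable.mono ?_ ((Set.countable_singleton x).union (Set.countable_range
        fun j => (⟨state n (flipDigit h j),
          state_mem_phaseSpace n (flipDigit_mem hh j)⟩ : phaseSpace)))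
      rintro y ⟨hyS, h', hh', hy⟩
      by_cases hxy : x = y
      · exact Or.inl hxy.symm
      right
      have hne : h ≠ h' := fun h0 => hxy (Subtype.ext (by rw [hx, hy, h0]))
      obtain ⟨j, hj⟩ := Function.ne_iff.1 hne
      refine ⟨j, Subtype.ext ?_⟩
      rw [hy, eq_flipDigit hh hh' hj]
      intro i hij
      by_contra hi
      obtain rfl : x = ⟨state n h, state_mem_phaseSpace n hh⟩ := Subtype.ext hx
      obtain rfl : y = ⟨state n h', state_mem_phaseSpace n hh'⟩ := Subtype.ext hy
      have hlow := (hS _ hxS _ hyS hxy).1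
      have hle : ∀ k, min ((2 : ℝ)⁻¹ ^ i) ((2 : ℝ)⁻¹ ^ j) ≤
          dist (phaseMap^[k] ⟨state n h, state_mem_phaseSpace n hh⟩)
            (phaseMap^[k] ⟨state n h', state_mem_phaseSpace n hh'⟩) := by
        intro k
        rw [Subtype.dist_eq, phaseMap_iterate_state n hh, phaseMap_iterate_state n hh']
        exact le_dist_state hh hh' hij hi hj _
      have hpos : (0 : ℝ) < min ((2 : ℝ)⁻¹ ^ i) ((2 : ℝ)⁻¹ ^ j) := by positivity
      have hbdd : IsBoundedUnder (· ≤ ·) atTop fun k : ℕ =>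
          dist (phaseMap^[k] ⟨state n h, state_mem_phaseSpace n hh⟩)
            (phaseMap^[k] ⟨state n h', state_mem_phaseSpace n hh'⟩) :=
        isBoundedUnder_of ⟨Metric.diam (Set.univ : Set phaseSpace), fun k =>
          Metric.dist_le_diam_of_mem isCompact_univ.isBounded (Set.mem_univ _) (Set.mem_univ _)⟩
      have := le_liminf_of_le hbdd.isCoboundedUnder_ge (Eventually.of_forall hle)
      linarith

theorem exists_connected_liYorkeSensitive :
    ∃ (Z : Type) (_ : MetricSpace Z) (G : Z → Z), CompactSpace Z ∧ PathConnectedSpace Z ∧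
      Continuous G ∧ LiYorkeSensitive G ∧ ∀ S : Set Z, IsScrambled G S → S.Countable := by
  have h0 : ((0 : ℝ), (0 : ℝ), (0 : ℕ → ℝ)) ∈ phaseSpace := Or.inl ⟨rfl, by simp [shapes]⟩
  exact exists_pathConnected_of_liYorkeSensitive continuous_phaseMap
    (phaseMap_of_fst_eq_zero (x := ⟨_, h0⟩) rfl) liYorkeSensitive_phaseMap
    countable_of_isScrambled_phaseMap

end Construction

/-- There exists a compact, pathwise connected metric space `Z` and a continuous map
`G : Z → Z` such that `(Z, G)` is Li-Yorke sensitive but every scrambled set of `(Z, G)`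
is at most countable; in particular there is a connected compact dynamical system which is
Li-Yorke sensitive but not Li-Yorke chaotic. -/
theorem connected_liYorke_sensitive_not_liYorke_chaotic :
    ∃ (Z : Type) (_ : MetricSpace Z) (G : Z → Z),
      CompactSpace Z ∧ PathConnectedSpace Z ∧ ConnectedSpace Z ∧ Continuous G ∧
      -- Li-Yorke sensitivity
      (∃ ε : ℝ, 0 < ε ∧ ∀ x : Z, ∀ U ∈ nhds x, ∃ y ∈ U,
        liminf (fun n : ℕ => dist (G^[n] x) (G^[n] y)) atTop = 0 ∧
        ε < limsup (fun n : ℕ => dist (G^[n] x) (G^[n] y)) atTop) ∧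
      -- every scrambled set is at most countable (no Li-Yorke chaos)
      (∀ S : Set Z,
        (∀ x ∈ S, ∀ y ∈ S, x ≠ y →
          liminf (fun n : ℕ => dist (G^[n] x) (G^[n] y)) atTop = 0 ∧
          ¬ Tendsto (fun n : ℕ => dist (G^[n] x) (G^[n] y)) atTop (nhds 0)) →
        S.Countable) := by
  obtain ⟨Z, hZ, G, hc, hpath, hG, hsens, hcount⟩ := exists_connected_liYorkeSensitive
  exact ⟨Z, hZ, G, hc, hpath, inferInstance, hG, hsens, hcount⟩
end
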